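/- Let f : ℝ → ℝ be smooth, μ ∈ ℝ with f(μ) < 0, and set h(s) = ∫_μ^s f(τ) dτ. Suppose there exists ν > μ with h(ν) = 0, h < 0 on (μ, ν), and f(ν) ≠ 0. Let u be the maximal solution of u'' + f(u) = 0 with u(0) = μ, u'(0) = 0, and let T be the supremum of all t > 0 such that u is defined on [0, t] and u' has no zero in (0, t]. Then T is finite, T lies in the domain of u, u(T) = ν, u'(T) = 0, and T = ∫_μ^ν (−2h(s))^{−1/2} ds. -/

import Mathlib

open Set Filter Topology MeasureTheory

/-- If a function on a half-line converges and so does its derivative, the latter tends to `0`. -/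
lemma eq_zero_of_tendsto_of_tendsto_hasDerivAt {g g' : ℝ → ℝ} {a c : ℝ}
    (hg : ∀ t, 0 < t → HasDerivAt g (g' t) t) (ha : Tendsto g atTop (𝓝 a))
    (hc : Tendsto g' atTop (𝓝 c)) : c = 0 := by
  have mean : ∀ t : ℝ, ∃ s, 0 < t → t < s ∧ g' s = g (t + 1) - g t := by
    intro t
    by_cases ht : 0 < t
    · obtain ⟨s, hs, hs'⟩ := exists_hasDerivAt_eq_slope g g' (lt_add_one t)
        (fun x hx => (hg x (ht.trans_le hx.1)).continuousAt.continuousWithinAt)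
        (fun x hx => hg x (ht.trans hx.1))
      exact ⟨s, fun _ => ⟨hs.1, by rw [hs']; simp⟩⟩
    · exact ⟨0, fun h => absurd h ht⟩
  choose s hs using mean
  have hs_top : Tendsto s atTop atTop :=
    tendsto_atTop_mono' _ ((eventually_gt_atTop 0).mono fun t ht => (hs t ht).1.le) tendsto_id
  have h_diff : Tendsto (fun t => g (t + 1) - g t) atTop (𝓝 (a - a)) :=
    (ha.comp (tendsto_atTop_add_const_right _ 1 tendsto_id)).sub ha
  rw [sub_self] at h_diff
  refine tendsto_nhds_unique (hc.comp hs_top) (h_diff.congr' ?_)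
  filter_upwards [eventually_gt_atTop 0] with t ht using (hs t ht).2.symm

/-- A solution of `u'' + f(u) = 0` starting at rest from a zero of an antiderivative `h` of `f`
has zero total energy. -/
lemma deriv_sq_eq_neg_two_mul_potential {f h u u' : ℝ → ℝ} {D : Set ℝ}
    (hh : ∀ s, HasDerivAt h (f s) s) (hD : IsOpen D) (hDconn : D.OrdConnected)
    (h0D : (0 : ℝ) ∈ D) (hu : ∀ t ∈ D, HasDerivAt u (u' t) t)
    (hu' : ∀ t ∈ D, HasDerivAt u' (-f (u t)) t) (hinit : h (u 0) = 0) (hinit' : u' 0 = 0)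
    {t : ℝ} (ht : t ∈ D) : u' t ^ 2 = -2 * h (u t) := by
  have hderiv : ∀ t ∈ D, HasDerivAt (fun t => u' t ^ 2 + 2 * h (u t)) 0 t := by
    intro t ht
    refine (((hu' t ht).pow 2).add (((hh (u t)).comp t (hu t ht)).const_mul 2)).congr_deriv ?_
    simp only [Nat.cast_ofNat]
    ring
  have := hD.is_const_of_deriv_eq_zero hDconn.isPreconnected
    (fun t ht => (hderiv t ht).differentiableAt.differentiableWithinAt)
    (fun t ht => (hderiv t ht).deriv) ht h0D
  simp only [hinit, hinit'] at this
  linarith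

/-- A function whose derivative is positive at a zero stays positive on any interval to the right
of it on which it is continuous and does not vanish. -/
lemma pos_of_hasDerivAt_pos_of_ne_zero {g : ℝ → ℝ} {c t : ℝ} (hg0 : g 0 = 0)
    (hg : HasDerivAt g c 0) (hc : 0 < c) (hcont : ContinuousOn g (Icc 0 t))
    (hne : ∀ s ∈ Ioc 0 t, g s ≠ 0) : ∀ s ∈ Ioc 0 t, 0 < g s := by
  intro s hs
  have hev : ∀ᶠ r in 𝓝[>] (0 : ℝ), 0 < g r := by
    have hslope := (hasDerivAt_iff_tendsto_slope.1 hg).mono_left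
      (nhdsWithin_mono 0 (fun x (hx : 0 < x) => hx.ne'))
    filter_upwards [hslope.eventually (lt_mem_nhds hc), self_mem_nhdsWithin] with r hr hr0
    rw [slope_def_field, hg0, sub_zero, sub_zero] at hr
    exact (div_pos_iff_of_pos_right hr0).1 hr
  obtain ⟨r, hr, hr0⟩ := (hev.and (Ioo_mem_nhdsGT hs.1)).exists
  by_contra! hle
  obtain ⟨x, hx, hx0⟩ := intermediate_value_Icc' hr0.2.le
    (hcont.mono (Icc_subset_Icc hr0.1.le hs.2)) ⟨hle, hr.le⟩
  exact hne x ⟨hr0.1.trans_le hx.1, hx.2.trans hs.2⟩ hx0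

/-- Extending `g` and `g'` by their left limits at `T` gives a function and its left derivative. -/
lemma hasDerivWithinAt_update_Icc {g g' : ℝ → ℝ} {T a c : ℝ} (hT : 0 < T)
    (hg : ∀ t ∈ Ico 0 T, HasDerivAt g (g' t) t) (ha : Tendsto g (𝓝[<] T) (𝓝 a))
    (hc : Tendsto g' (𝓝[<] T) (𝓝 c)) :
    ∀ t ∈ Icc 0 T, HasDerivWithinAt (Function.update g T a) (Function.update g' T c t)
      (Icc 0 T) t := by
  have heq : ∀ t, t < T → Function.update g T a =ᶠ[𝓝 t] g := by
    intro t ht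
    filter_upwards [Iio_mem_nhds ht] with s hs using Function.update_of_ne (ne_of_lt hs) _ _
  have hderiv : ∀ t ∈ Ico 0 T, HasDerivAt (Function.update g T a) (g' t) t :=
    fun t ht => (hg t ht).congr_of_eventuallyEq (heq t ht.2)
  intro t ht
  rcases ht.2.lt_or_eq with hlt | rfl
  · rw [Function.update_of_ne hlt.ne]
    exact (hderiv t ⟨ht.1, hlt⟩).hasDerivWithinAt
  · rw [Function.update_self]
    have hIoo : Ioo 0 t ∈ 𝓝[<] t := Ioo_mem_nhdsLT hT
    refine HasDerivWithinAt.mono (hasDerivWithinAt_Iic_of_tendsto_deriv (s := Ioo 0 t)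
      (fun s hs => (hderiv s ⟨hs.1.le, hs.2⟩).differentiableAt.differentiableWithinAt)
      ?_ hIoo ?_) Icc_subset_Iic_self
    · rw [ContinuousWithinAt, Function.update_self]
      refine (ha.mono_left (nhdsWithin_mono _ fun s hs => hs.2)).congr' ?_
      filter_upwards [self_mem_nhdsWithin] with s hs
      exact (Function.update_of_ne (ne_of_lt hs.2) _ _).symm
    · refine hc.congr' ?_
      filter_upwards [hIoo] with s hs using (hderiv s ⟨hs.1.le, hs.2⟩).deriv.symm

/-- Compact-type case. Let `f(μ) < 0`, `h(s) = ∫_μ^s f`, and suppose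
`ν > μ` satisfies `h(ν) = 0`, `h < 0` on `(μ, ν)` and `f(ν) ≠ 0`. Let `u` be the
maximal solution of `u'' + f(u) = 0`, `u(0) = μ`, `u'(0) = 0` (maximality is expressed
by saying that the domain `D` of `u` contains the domain of any solution of the same
initial value problem), and let `T` be the supremum of all `t > 0` such that `[0, t]`
is contained in the domain and `u'` has no zero in `(0, t]`. Then `T` is finite
(the supremum exists in ℝ), `T` lies in the domain of `u`, `u(T) = ν`, `u'(T) = 0`,
and `T = ∫_μ^ν (−2h(s))^{−1/2} ds`. -/
theorem obata_ode_compact_type_reaches_nu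
    (f : ℝ → ℝ) (hf : ContDiff ℝ (⊤ : ℕ∞) f) (μ ν : ℝ) (hμν : μ < ν) (hfμ : f μ < 0)
    (h : ℝ → ℝ) (hh : ∀ s : ℝ, h s = ∫ τ in μ..s, f τ)
    (hν : h ν = 0) (hneg : ∀ s ∈ Set.Ioo μ ν, h s < 0) (hfν : f ν ≠ 0)
    (D : Set ℝ) (hD : IsOpen D) (hDconn : D.OrdConnected) (h0D : (0 : ℝ) ∈ D)
    (u u' u'' : ℝ → ℝ)
    (hu : ∀ t ∈ D, HasDerivAt u (u' t) t)
    (hu' : ∀ t ∈ D, HasDerivAt u' (u'' t) t)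
    (hode : ∀ t ∈ D, u'' t + f (u t) = 0)
    (hinit : u 0 = μ) (hinit' : u' 0 = 0)
    (hmax : ∀ (v v' v'' : ℝ → ℝ) (E : Set ℝ), E.OrdConnected → (0 : ℝ) ∈ E →
      (∀ t ∈ E, HasDerivWithinAt v (v' t) E t) →
      (∀ t ∈ E, HasDerivWithinAt v' (v'' t) E t) →
      (∀ t ∈ E, v'' t + f (v t) = 0) → v 0 = μ → v' 0 = 0 → E ⊆ D) :
    ∃ T : ℝ,
      IsLUB {t : ℝ | 0 < t ∧ Set.Icc 0 t ⊆ D ∧ ∀ s ∈ Set.Ioc 0 t, u' s ≠ 0} T ∧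
      T ∈ D ∧ u T = ν ∧ u' T = 0 ∧
      T = ∫ s in μ..ν, 1 / Real.sqrt (-2 * h s) := by
  have hh' : ∀ s, HasDerivAt h (f s) s := by
    intro s
    rw [funext hh]
    exact hf.continuous.integral_hasStrictDerivAt μ s |>.hasDerivAt
  have hhc : Continuous h := continuous_iff_continuousAt.2 fun s => (hh' s).continuousAt
  have hhμ : h μ = 0 := by simp [hh]
  have hu'f : ∀ t ∈ D, HasDerivAt u' (-f (u t)) t := fun t ht => by
    rw [← eq_neg_of_add_eq_zero_left (hode t ht)]
    exact hu' t ht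
  have henergy : ∀ t ∈ D, u' t ^ 2 = -2 * h (u t) := fun t ht =>
    deriv_sq_eq_neg_two_mul_potential hh' hD hDconn h0D hu hu'f (by rw [hinit, hhμ]) hinit' ht
  have hf0 : 0 < -f (u 0) := by rw [hinit]; linarith
  set S := {t : ℝ | 0 < t ∧ Icc 0 t ⊆ D ∧ ∀ s ∈ Ioc 0 t, u' s ≠ 0}
  have hSmono : ∀ t ∈ S, ∀ s, 0 < s → s ≤ t → s ∈ S := fun t ht s hs hst =>
    ⟨hs, (Icc_subset_Icc_right hst).trans ht.2.1,
      fun r hr => ht.2.2 r (Ioc_subset_Ioc_right hst hr)⟩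
  have hSD : ∀ t ∈ S, t ∈ D := fun t ht => ht.2.1 (right_mem_Icc.2 ht.1.le)
  have hpos : ∀ t ∈ S, 0 < u' t := fun t ht =>
    pos_of_hasDerivAt_pos_of_ne_zero hinit' (hu'f 0 h0D) hf0
      (fun s hs => (hu' s (ht.2.1 hs)).continuousAt.continuousWithinAt) ht.2.2 t
      (right_mem_Ioc.2 ht.1)
  have hmono : ∀ t ∈ S, StrictMonoOn u (Icc 0 t) := by
    intro t ht
    refine strictMonoOn_of_deriv_pos (convex_Icc 0 t)
      (fun s hs => (hu s (ht.2.1 hs)).continuousAt.continuousWithinAt) fun s hs => ?_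
    rw [interior_Icc] at hs
    rw [(hu s (ht.2.1 (Ioo_subset_Icc_self hs))).deriv]
    exact hpos s (hSmono t ht s hs.1 hs.2.le)
  have hgt : ∀ t ∈ S, μ < u t := fun t ht => by
    rw [← hinit]
    exact hmono t ht (left_mem_Icc.2 ht.1.le) (right_mem_Icc.2 ht.1.le) ht.1
  have hlt : ∀ t ∈ S, u t < ν := by
    intro t ht
    by_contra! hle
    obtain ⟨s, hs, hsν⟩ := intermediate_value_Icc ht.1.le
      (fun s hs => (hu s (ht.2.1 hs)).continuousAt.continuousWithinAt)
      (show ν ∈ Icc (u 0) (u t) from ⟨hinit ▸ hμν.le, hle⟩)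
    have hs0 : 0 < s := hs.1.lt_of_ne fun h0 => by
      rw [← h0, hinit] at hsν
      exact hμν.ne hsν
    refine ht.2.2 s ⟨hs0, hs.2⟩ (pow_eq_zero_iff two_ne_zero |>.1 ?_)
    rw [henergy s (ht.2.1 hs), hsν, hν, mul_zero]
  have hsqrt : ∀ t ∈ S, u' t = √(-2 * h (u t)) := fun t ht => by
    rw [← henergy t (hSD t ht), Real.sqrt_sq (hpos t ht).le]
  have hextend : ∀ t ∈ D, 0 ≤ t → (∀ s ∈ Ioc 0 t, u' s ≠ 0) → (∀ᶠ s in 𝓝[>] t, u' s ≠ 0) →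
      ∃ r ∈ S, t < r := by
    intro t ht ht0 hne hev
    have hDev : ∀ᶠ s in 𝓝[>] t, s ∈ D := nhdsWithin_le_nhds (hD.mem_nhds ht)
    obtain ⟨r, hr, hsub⟩ := mem_nhdsGT_iff_exists_Ioc_subset.1 (hev.and hDev)
    rw [mem_Ioi] at hr
    refine ⟨r, ⟨ht0.trans_lt hr, hDconn.out h0D (hsub (right_mem_Ioc.2 hr)).2, fun s hs => ?_⟩, hr⟩
    rcases le_or_gt s t with hst | hst
    · exact hne s ⟨hs.1, hst⟩
    · exact (hsub ⟨hst, hs.2⟩).1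
  obtain ⟨t₀, ht₀, -⟩ := hextend 0 h0D le_rfl (by simp)
    (nhdsWithin_mono 0 (fun s (hs : 0 < s) => hs.ne')
      ((hu'f 0 h0D).eventually_ne hf0.ne'))
  have hlim : ∀ {l : Filter ℝ} {L : ℝ}, (∀ᶠ t in l, t ∈ S) → Tendsto u l (𝓝 L) →
      Tendsto u' l (𝓝 √(-2 * h L)) ∧ Tendsto (fun t => -f (u t)) l (𝓝 (-f L)) := by
    intro l L hl hL
    refine ⟨?_, ((hf.continuous.tendsto L).comp hL).neg⟩
    refine ((Real.continuous_sqrt.comp (hhc.const_mul (-2))).tendsto L |>.comp hL).congr' ?_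
    filter_upwards [hl] with t ht using (hsqrt t ht).symm
  have hbdd : BddAbove S := by
    by_contra hunb
    have hall : ∀ t, 0 < t → t ∈ S := fun t ht => by
      obtain ⟨r, hr, htr⟩ := not_bddAbove_iff.1 hunb t
      exact hSmono r hr t ht htr.le
    have humono : Monotone fun t => u (max 0 t) := by
      intro a b hab
      have hb : b ≤ max 1 b := le_max_right _ _
      refine (hmono (max 1 b) (hall _ (by positivity))).monotoneOn ⟨le_max_left _ _, ?_⟩
        ⟨le_max_left _ _, ?_⟩ (max_le_max_left 0 hab)
      · exact max_le (by positivity) (hab.trans hb)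
      · exact max_le (by positivity) hb
    have hubdd : ∀ t, u (max 0 t) ≤ ν := by
      intro t
      rcases le_or_gt t 0 with ht | ht
      · rw [max_eq_left ht, hinit]
        exact hμν.le
      · rw [max_eq_right ht.le]
        exact (hlt t (hall t ht)).le
    obtain ⟨L, hL⟩ : ∃ L, Tendsto u atTop (𝓝 L) := by
      refine ⟨_, (tendsto_atTop_ciSup humono ⟨ν, forall_mem_range.2 hubdd⟩).congr' ?_⟩
      filter_upwards [eventually_ge_atTop 0] with t ht
      rw [max_eq_right ht]
    obtain ⟨hL', hL''⟩ := hlim ((eventually_gt_atTop 0).mono hall) hL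
    have hL0 := eq_zero_of_tendsto_of_tendsto_hasDerivAt
      (fun t ht => hu t (hSD t (hall t ht))) hL hL'
    have hfL := eq_zero_of_tendsto_of_tendsto_hasDerivAt
      (fun t ht => hu'f t (hSD t (hall t ht))) hL' hL''
    have hμL : μ < L := (hgt 1 (hall 1 one_pos)).trans_le <| ge_of_tendsto hL <| by
      filter_upwards [eventually_ge_atTop 1] with t ht
      exact (hmono t (hall t (by linarith))).monotoneOn ⟨by linarith, ht⟩
        ⟨by linarith, le_rfl⟩ ht
    have hLν : L ≤ ν := le_of_tendsto hL <| by
      filter_upwards [eventually_gt_atTop 0] with t ht using (hlt t (hall t ht)).le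
    rcases hLν.lt_or_eq with hLν | rfl
    · have := hneg L ⟨hμL, hLν⟩
      have := Real.sqrt_pos.2 (show 0 < -2 * h L by linarith)
      exact this.ne' hL0
    · exact hfν (neg_eq_zero.1 hfL)
  obtain ⟨T, hT⟩ : ∃ T, IsLUB S T := ⟨_, isLUB_csSup ⟨t₀, ht₀⟩ hbdd⟩
  have hTpos : 0 < T := ht₀.1.trans_le (hT.1 ht₀)
  have hTS : ∀ t ∈ Ioo 0 T, t ∈ S := fun t ht => by
    obtain ⟨r, hr, htr⟩ := (lt_isLUB_iff hT).1 ht.2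
    exact hSmono r hr t ht.1 htr.le
  have hTD' : Ico 0 T ⊆ D := fun t ht => by
    rcases ht.1.eq_or_lt with rfl | h0
    · exact h0D
    · exact hSD t (hTS t ⟨h0, ht.2⟩)
  have hTmono : StrictMonoOn u (Ico 0 T) := fun a ha b hb hab =>
    hmono b (hTS b ⟨ha.1.trans_lt hab, hb.2⟩) ⟨ha.1, hab.le⟩ ⟨hb.1, le_rfl⟩ hab
  have hTD : T ∈ D := by
    have hL := (hTmono.monotoneOn.mono Ioo_subset_Ico_self).tendsto_nhdsWithin_Ioo_left
      (nonempty_Ioo.2 hTpos) ⟨ν, forall_mem_image.2 fun t ht => (hlt t (hTS t ht)).le⟩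
    set L := sSup (u '' Ioo 0 T)
    obtain ⟨hL', hL''⟩ := hlim (by filter_upwards [Ioo_mem_nhdsLT hTpos] with t ht using hTS t ht) hL
    refine hmax _ _ _ (Icc 0 T) ordConnected_Icc ⟨le_rfl, hTpos.le⟩
      (hasDerivWithinAt_update_Icc hTpos (fun t ht => hu t (hTD' ht)) hL hL')
      (hasDerivWithinAt_update_Icc hTpos (fun t ht => hu'f t (hTD' ht)) hL' hL'')
      (fun t ht => ?_) ?_ ?_ ⟨hTpos.le, le_rfl⟩
    · rcases eq_or_ne t T with rfl | hne
      · simp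
      · simp [hne]
    · simp [hTpos.ne, hinit]
    · simp [hTpos.ne, hinit']
  have hTmono' : StrictMonoOn u (Icc 0 T) := by
    refine strictMonoOn_of_deriv_pos (convex_Icc 0 T)
      (fun s hs => (hu s (hDconn.out h0D hTD hs)).continuousAt.continuousWithinAt) fun s hs => ?_
    rw [interior_Icc] at hs
    rw [(hu s (hSD s (hTS s hs))).deriv]
    exact hpos s (hTS s hs)
  have hu'T : u' T = 0 := by
    by_contra hne
    obtain ⟨r, hr, hTr⟩ := hextend T hTD hTpos.le
      (fun s hs => by
        rcases hs.2.lt_or_eq with hsT | rfl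
        · exact (hpos s (hTS s ⟨hs.1, hsT⟩)).ne'
        · exact hne)
      (nhdsWithin_le_nhds ((hu' T hTD).continuousAt.eventually_ne hne))
    exact (hT.1 hr).not_gt hTr
  have hcont : ContinuousOn u (Icc 0 T) := fun s hs =>
    (hu s (hDconn.out h0D hTD hs)).continuousAt.continuousWithinAt
  have huT : u T = ν := by
    have hμT : μ < u T := hinit ▸ hTmono' ⟨le_rfl, hTpos.le⟩ ⟨hTpos.le, le_rfl⟩ hTpos
    have hTν : u T ≤ ν := le_of_tendsto
      ((hu T hTD).continuousAt.continuousWithinAt (s := Iio T)).tendsto <| by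
        filter_upwards [Ioo_mem_nhdsLT hTpos] with t ht using (hlt t (hTS t ht)).le
    by_contra hne
    have hlt0 := hneg _ ⟨hμT, hTν.lt_of_ne hne⟩
    have := henergy T hTD
    rw [hu'T] at this
    linarith
  refine ⟨T, hT, hTD, huT, hu'T, ?_⟩
  have himage : u '' Ioo 0 T = Ioo μ ν := by
    apply Subset.antisymm
    · rintro _ ⟨t, ht, rfl⟩
      exact ⟨hgt t (hTS t ht), hlt t (hTS t ht)⟩
    · have := intermediate_value_Ioo hTpos.le hcont
      rwa [hinit, huT] at this
  rw [intervalIntegral.integral_of_le hμν.le, integral_Ioc_eq_integral_Ioo, ← himage,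
    integral_image_eq_integral_abs_deriv_smul measurableSet_Ioo
      (fun t ht => (hu t (hSD t (hTS t ht))).hasDerivWithinAt)
      (hTmono'.injOn.mono Ioo_subset_Icc_self),
    setIntegral_congr_fun measurableSet_Ioo (g := fun _ => (1 : ℝ))]
  · simp [hTpos.le]
  · intro t ht
    have htS := hTS t ht
    simp only [smul_eq_mul]
    rw [← hsqrt t htS, abs_of_pos (hpos t htS), mul_one_div_cancel (hpos t htS).ne']
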